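/- Consider the problem ${\rm APP} = \{{\rm APP}_{\infty,d}\}_{d \in \mathbb{N}}$ in the worst case setting for the absolute or normalized error criterion $\star \in \{{\rm ABS}, {\rm NOR}\}$. Then ${\rm APP}$ is exponentially uniformly weakly tractable (EXP-UWT) for $\Lambda^{\rm all}$ if and only if it is EXP-UWT for $\Lambda^{\rm std}$. -/

import Mathlib

open Filter
open scoped ENNReal NNReal

noncomputable section

/-- Coefficient space: `ℓ²` sequences indexed by `ℤ^d`.  An element `u` represents the
function `f ∈ H^ω(𝕋^d)` with Fourier coefficients `f̂(k) = u k / ω k`, so that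
`‖u‖_{ℓ²} = ‖f‖_{H^ω}`. -/
abbrev Coef (d : ℕ) := lp (fun _ : Fin d → ℤ => ℂ) 2

/-- The periodic function represented by the coefficients `u`:
`f(x) = ∑_{k ∈ ℤ^d} (u k / ω k) e^{2πi k·x}`. -/
def torusFn {d : ℕ} (ω : (Fin d → ℤ) → ℝ) (u : Coef d) (x : Fin d → ℝ) : ℂ :=
  ∑' k : Fin d → ℤ,
    ((ω k : ℂ))⁻¹ * u k * Complex.exp (2 * Real.pi * Complex.I * ∑ j, (k j : ℂ) * (x j : ℂ))

/-- The torus `𝕋^d`, modelled as the cube `[0,1]^d`. -/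
def cube (d : ℕ) : Set (Fin d → ℝ) := {x | ∀ j, x j ∈ Set.Icc (0 : ℝ) 1}

/-- Standard information: point-evaluation functionals `f ↦ f(x)`. -/
def stdInfo {d : ℕ} (ω : (Fin d → ℤ) → ℝ) : Set (Coef d → ℂ) :=
  {L | ∃ x ∈ cube d, L = fun u => torusFn ω u x}

/-- General linear information: all continuous linear functionals on `H^ω`. -/
def allInfo (d : ℕ) : Set (Coef d → ℂ) := {L | ∃ T : Coef d →L[ℂ] ℂ, L = ⇑T}

/-- The `n`-th minimal worst case error `e(n, APP_{∞,d}; Λ)` of `L_∞`-approximation on the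
unit ball of `H^ω(𝕋^d)`, using algorithms `f ↦ φ(L₁ f, …, Lₙ f)` with `Lᵢ ∈ Λ`. -/
def wcErr {d : ℕ} (ω : (Fin d → ℤ) → ℝ) (Λ : Set (Coef d → ℂ)) (n : ℕ) : ℝ≥0∞ :=
  ⨅ (L : Fin n → Coef d → ℂ) (_ : ∀ i, L i ∈ Λ) (φ : (Fin n → ℂ) → (Fin d → ℝ) → ℂ),
    ⨆ (u : Coef d) (_ : ‖u‖ ≤ 1) (x : Fin d → ℝ) (_ : x ∈ cube d),
      (‖torusFn ω u x - φ (fun i => L i u) x‖₊ : ℝ≥0∞)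

/-- The initial error `e(0, APP_{∞,d}) = sup_{‖f‖_{H^ω} ≤ 1} ‖f‖_∞`. -/
def initErr {d : ℕ} (ω : (Fin d → ℤ) → ℝ) : ℝ≥0∞ :=
  ⨆ (u : Coef d) (_ : ‖u‖ ≤ 1) (x : Fin d → ℝ) (_ : x ∈ cube d),
    (‖torusFn ω u x‖₊ : ℝ≥0∞)

/-- The error criterion: absolute (ABS) or normalized (NOR). -/
inductive Crit | ABS | NOR

/-- `CRI_d`: the normalizing quantity of the error criterion. -/
def CRI {d : ℕ} (ω : (Fin d → ℤ) → ℝ) : Crit → ℝ≥0∞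
  | Crit.ABS => 1
  | Crit.NOR => initErr ω

/-- The information complexity `n^⋆(ε, d; Λ)`. -/
def infoComp {d : ℕ} (ω : (Fin d → ℤ) → ℝ) (Λ : Set (Coef d → ℂ)) (crit : Crit) (ε : ℝ) : ℕ :=
  sInf {n : ℕ | wcErr ω Λ n ≤ ENNReal.ofReal ε * CRI ω crit}

/-- Algebraic strong polynomial tractability of the family of information complexities `nc`. -/
def ALGSPT (nc : ℕ → ℝ → ℕ) : Prop :=
  ∃ C > (0:ℝ), ∃ p ≥ (0:ℝ), ∀ d : ℕ, 0 < d → ∀ ε ∈ Set.Ioo (0:ℝ) 1,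
    (nc d ε : ℝ) ≤ C * ε ^ (-p)

/-- The exponent of algebraic strong polynomial tractability. -/
def ALGSPTexp (nc : ℕ → ℝ → ℕ) : ℝ :=
  sInf {p : ℝ | 0 ≤ p ∧ ∃ C > (0:ℝ), ∀ d : ℕ, 0 < d → ∀ ε ∈ Set.Ioo (0:ℝ) 1,
    (nc d ε : ℝ) ≤ C * ε ^ (-p)}

/-- Algebraic polynomial tractability. -/
def ALGPT (nc : ℕ → ℝ → ℕ) : Prop :=
  ∃ C > (0:ℝ), ∃ p ≥ (0:ℝ), ∃ q ≥ (0:ℝ), ∀ d : ℕ, 0 < d → ∀ ε ∈ Set.Ioo (0:ℝ) 1,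
    (nc d ε : ℝ) ≤ C * (d : ℝ) ^ q * ε ^ (-p)

/-- Algebraic quasi-polynomial tractability. -/
def ALGQPT (nc : ℕ → ℝ → ℕ) : Prop :=
  ∃ C > (0:ℝ), ∃ t ≥ (0:ℝ), ∀ d : ℕ, 0 < d → ∀ ε ∈ Set.Ioo (0:ℝ) 1,
    (nc d ε : ℝ) ≤ C * Real.exp (t * (1 + Real.log d) * (1 + Real.log ε⁻¹))

/-- The exponent of algebraic quasi-polynomial tractability. -/
def ALGQPTexp (nc : ℕ → ℝ → ℕ) : ℝ :=
  sInf {t : ℝ | 0 ≤ t ∧ ∃ C > (0:ℝ), ∀ d : ℕ, 0 < d → ∀ ε ∈ Set.Ioo (0:ℝ) 1,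
    (nc d ε : ℝ) ≤ C * Real.exp (t * (1 + Real.log d) * (1 + Real.log ε⁻¹))}

/-- Exponential quasi-polynomial tractability. -/
def EXPQPT (nc : ℕ → ℝ → ℕ) : Prop :=
  ∃ C > (0:ℝ), ∃ t ≥ (0:ℝ), ∀ d : ℕ, 0 < d → ∀ ε ∈ Set.Ioo (0:ℝ) 1,
    (nc d ε : ℝ) ≤ C * Real.exp (t * (1 + Real.log d) * (1 + Real.log (Real.log ε⁻¹ + 1)))

/-- The exponent of exponential quasi-polynomial tractability. -/
def EXPQPTexp (nc : ℕ → ℝ → ℕ) : ℝ :=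
  sInf {t : ℝ | 0 ≤ t ∧ ∃ C > (0:ℝ), ∀ d : ℕ, 0 < d → ∀ ε ∈ Set.Ioo (0:ℝ) 1,
    (nc d ε : ℝ) ≤ C * Real.exp (t * (1 + Real.log d) * (1 + Real.log (Real.log ε⁻¹ + 1)))}

/-- `lim_{ε⁻¹ + d → ∞} (log nc(d, ε)) / den(d, ε) = 0`. -/
def WTlim (den : ℕ → ℝ → ℝ) (nc : ℕ → ℝ → ℕ) : Prop :=
  ∀ δ > (0:ℝ), ∃ M : ℝ, ∀ d : ℕ, 0 < d → ∀ ε ∈ Set.Ioo (0:ℝ) 1,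
    M ≤ ε⁻¹ + d → |Real.log (nc d ε) / den d ε| < δ

/-- Algebraic `(s,t)`-weak tractability; `ALGWTst 1 1` is algebraic weak tractability. -/
def ALGWTst (s t : ℝ) (nc : ℕ → ℝ → ℕ) : Prop :=
  WTlim (fun d ε => ε ^ (-s) + (d : ℝ) ^ t) nc

/-- Algebraic uniform weak tractability. -/
def ALGUWT (nc : ℕ → ℝ → ℕ) : Prop := ∀ α > (0:ℝ), ∀ β > (0:ℝ), ALGWTst α β nc

/-- Exponential `(s,t)`-weak tractability; `EXPWTst 1 1` is exponential weak tractability. -/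
def EXPWTst (s t : ℝ) (nc : ℕ → ℝ → ℕ) : Prop :=
  WTlim (fun d ε => (1 + Real.log ε⁻¹) ^ s + (d : ℝ) ^ t) nc

/-- Exponential uniform weak tractability. -/
def EXPUWT (nc : ℕ → ℝ → ℕ) : Prop := ∀ α > (0:ℝ), ∀ β > (0:ℝ), EXPWTst α β nc

/-- The character `x ↦ e^{2πi k·x}`. -/
def chr {d : ℕ} (k : Fin d → ℤ) (x : Fin d → ℝ) : ℂ :=
  Complex.exp (2 * Real.pi * Complex.I * ∑ j, (k j : ℂ) * (x j : ℂ))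

lemma chr_norm {d : ℕ} (k : Fin d → ℤ) (x : Fin d → ℝ) : ‖chr k x‖ = 1 := by
  have : (2 * Real.pi * Complex.I * ∑ j, (k j : ℂ) * (x j : ℂ))
      = ((2 * Real.pi * ∑ j, (k j : ℝ) * (x j : ℝ) : ℝ) : ℂ) * Complex.I := by
    push_cast; ring
  rw [chr, this, Complex.norm_exp_ofReal_mul_I]

lemma chr_cont {d : ℕ} (k : Fin d → ℤ) : Continuous (chr k) := by
  unfold chr; fun_prop

lemma kmem {d : ℕ} {ω : (Fin d → ℤ) → ℝ} (hs : Summable fun k => ((ω k) ^ 2)⁻¹)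
    (x : Fin d → ℝ) :
    Memℓp (E := fun _ : Fin d → ℤ => ℂ)
      (fun k => (starRingEnd ℂ) ((ω k : ℂ)⁻¹ * chr k x)) 2 := by
  apply memℓp_gen
  refine hs.congr fun k => ?_
  simp [chr_norm]

/-- representer of point evaluation -/
def repK {d : ℕ} {ω : (Fin d → ℤ) → ℝ} (hs : Summable fun k => ((ω k) ^ 2)⁻¹)
    (x : Fin d → ℝ) : Coef d := ⟨_, kmem hs x⟩

lemma torusFn_eq {d : ℕ} {ω : (Fin d → ℤ) → ℝ} (hs : Summable fun k => ((ω k) ^ 2)⁻¹)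
    (u : Coef d) (x : Fin d → ℝ) : torusFn ω u x = inner ℂ (repK hs x) u := by
  rw [lp.inner_eq_tsum]
  unfold torusFn
  refine tsum_congr fun k => ?_
  simp [repK, chr, RCLike.inner_apply]
  ring

lemma ker_cont {d : ℕ} {ω : (Fin d → ℤ) → ℝ} (hs : Summable fun k => ((ω k) ^ 2)⁻¹) :
    Continuous (repK hs) := by
  rw [continuous_iff_continuousAt]
  intro y
  have h : ∀ x, ‖repK hs x - repK hs y‖ ^ 2 = ∑' k, ((ω k) ^ 2)⁻¹ * ‖chr k x - chr k y‖ ^ 2 := by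
    intro x
    have := lp.norm_rpow_eq_tsum (p := 2) (by norm_num) (repK hs x - repK hs y)
    norm_num at this
    rw [this]
    refine tsum_congr fun k => ?_
    have : (repK hs x) k - (repK hs y) k =
      (starRingEnd ℂ) ((ω k : ℂ)⁻¹ * (chr k x - chr k y)) := by
      simp [repK]; ring
    rw [this, RCLike.norm_conj, norm_mul, mul_pow]
    simp
  have hc : Continuous fun x => ∑' k, ((ω k) ^ 2)⁻¹ * ‖chr k x - chr k y‖ ^ 2 := by
    refine continuous_tsum (u := fun k => ((ω k) ^ 2)⁻¹ * 4) ?_ (hs.mul_right 4) ?_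
    · intro k
      have := chr_cont k
      fun_prop
    · intro k x
      rw [Real.norm_of_nonneg (by positivity)]
      gcongr
      have := norm_sub_le (chr k x) (chr k y)
      rw [chr_norm, chr_norm] at this
      nlinarith [norm_nonneg (chr k x - chr k y)]
  rw [ContinuousAt, tendsto_iff_norm_sub_tendsto_zero]
  have h2 := (hc.tendsto y)
  simp only [← h] at h2
  have h3 := h2.sqrt
  simpa using h3

lemma cube_compact (d : ℕ) : IsCompact (cube d) := by
  have : cube d = Set.univ.pi fun _ => Set.Icc (0:ℝ) 1 := by
    ext x; simp only [cube, Set.mem_pi, Set.mem_setOf_eq, Set.mem_univ, true_implies]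
  rw [this]
  exact isCompact_univ_pi fun _ => isCompact_Icc

lemma std_sub_all {d : ℕ} {ω : (Fin d → ℤ) → ℝ} (hs : Summable fun k => ((ω k) ^ 2)⁻¹) :
    stdInfo ω ⊆ allInfo d := by
  rintro L ⟨x, -, rfl⟩
  refine ⟨innerSL ℂ (repK hs x), ?_⟩
  ext u
  simp [torusFn_eq hs]

lemma wcErr_anti {d : ℕ} {ω : (Fin d → ℤ) → ℝ} (hs : Summable fun k => ((ω k) ^ 2)⁻¹) (n : ℕ) :
    wcErr ω (allInfo d) n ≤ wcErr ω (stdInfo ω) n := by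
  unfold wcErr
  refine le_iInf fun L => le_iInf fun hL => ?_
  exact iInf₂_le L (fun i => std_sub_all hs (hL i))

lemma std_nonempty {d : ℕ} {ω : (Fin d → ℤ) → ℝ} (hs : Summable fun k => ((ω k) ^ 2)⁻¹)
    {a : ℝ≥0∞} (ha : 0 < a) : ∃ n, wcErr ω (stdInfo ω) n ≤ a := by
  obtain ⟨η, hη, hηa⟩ : ∃ η : ℝ, 0 < η ∧ ENNReal.ofReal η ≤ a := by
    obtain ⟨r, h0, h1⟩ := ENNReal.lt_iff_exists_nnreal_btwn.1 ha
    exact ⟨r, by exact_mod_cast h0, by simpa using h1.le⟩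
  obtain ⟨t, htc, hcov⟩ := (cube_compact d).elim_nhds_subcover
    (fun y => {x | ‖repK hs x - repK hs y‖ < η}) (by
      intro y _
      refine (isOpen_lt (((ker_cont hs).sub continuous_const).norm) continuous_const).mem_nhds ?_
      simpa using hη)
  refine ⟨t.card, le_trans ?_ hηa⟩
  have hch : ∀ x, ∃ i : Fin t.card, x ∈ cube d →
      ‖repK hs x - repK hs (t.equivFin.symm i : Fin d → ℝ)‖ < η := by
    intro x
    by_cases hx : x ∈ cube d
    · have := hcov hx
      simp only [Set.mem_iUnion] at this
      obtain ⟨y, hy, hxy⟩ := this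
      refine ⟨t.equivFin ⟨y, hy⟩, fun _ => ?_⟩
      simpa using hxy
    · have h0 : (0 : Fin d → ℝ) ∈ cube d := fun j => by simp
      have := hcov h0
      simp only [Set.mem_iUnion] at this
      obtain ⟨y, hy, hxy⟩ := this
      exact ⟨t.equivFin ⟨y, hy⟩, fun h => absurd h hx⟩
  choose c hc using hch
  unfold wcErr
  refine iInf₂_le_of_le (fun i u => torusFn ω u (t.equivFin.symm i : Fin d → ℝ))
    (fun i => ⟨_, htc _ (t.equivFin.symm i).2, rfl⟩) ?_
  refine iInf_le_of_le (fun y x => y (c x)) ?_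
  refine iSup₂_le fun u hu => iSup₂_le fun x hx => ?_
  have hfin : ‖torusFn ω u x - torusFn ω u (t.equivFin.symm (c x) : Fin d → ℝ)‖ ≤ η := by
    rw [torusFn_eq hs, torusFn_eq hs, ← inner_sub_left]
    refine (norm_inner_le_norm _ _).trans ?_
    nlinarith [hc x hx, norm_nonneg u,
      norm_nonneg (repK hs x - repK hs (t.equivFin.symm (c x) : Fin d → ℝ))]
  have h3 := ENNReal.ofReal_le_ofReal hfin
  rwa [ofReal_norm] at h3

lemma fekete {V : Type*} [NormedAddCommGroup V] [NormedSpace ℂ V] [FiniteDimensional ℂ V]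
    {X : Type*} [TopologicalSpace X] [CompactSpace X] (v : X → V) (hv : Continuous v)
    (hspan : Submodule.span ℂ (Set.range v) = ⊤) :
    ∃ (p : Fin (Module.finrank ℂ V) → X) (l : X → Fin (Module.finrank ℂ V) → ℂ),
      (∀ x i, ‖l x i‖ ≤ 1) ∧ ∀ x, v x = ∑ i, l x i • v (p i) := by
  classical
  let b := Module.finBasis ℂ V
  have hcont : Continuous fun p : Fin (Module.finrank ℂ V) → X => ‖b.det (v ∘ p)‖ := by
    refine Continuous.norm ?_
    simp only [Module.Basis.det_apply]
    refine Continuous.matrix_det ?_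
    refine continuous_matrix fun i j => ?_
    simp only [Module.Basis.toMatrix_apply, Function.comp]
    have : Continuous fun w : V => b.repr w i :=
      (b.coord i).continuous_of_finiteDimensional
    exact this.comp (hv.comp (continuous_apply j))
  obtain ⟨p0, hp0⟩ : ∃ p0 : Fin (Module.finrank ℂ V) → X, b.det (v ∘ p0) ≠ 0 := by
    obtain ⟨f, hf, hsp, hli⟩ := Submodule.exists_fun_fin_finrank_span_eq ℂ (Set.range v)
    replace hsp := hsp.trans hspan
    have hfr : Module.finrank ℂ (Submodule.span ℂ (Set.range v)) = Module.finrank ℂ V := by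
      rw [hspan, finrank_top]
    choose q hq using hf
    let e := finCongr hfr.symm
    refine ⟨fun i => q (e i), ?_⟩
    have h1 : v ∘ (fun i => q (e i)) = f ∘ e := by
      ext i; simp [hq]
    rw [h1]
    refine ((Module.Basis.is_basis_iff_det b).1 ⟨hli.comp _ e.injective, ?_⟩).ne_zero
    rw [e.surjective.range_comp, hsp]
  obtain ⟨p, -, hp⟩ := isCompact_univ.exists_isMaxOn (⟨p0, trivial⟩ : Set.univ.Nonempty)
    hcont.continuousOn
  have hpmax : ∀ q, ‖b.det (v ∘ q)‖ ≤ ‖b.det (v ∘ p)‖ := fun q => hp (Set.mem_univ q)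
  have hpne : b.det (v ∘ p) ≠ 0 := by
    have := hpmax p0
    have h0 : 0 < ‖b.det (v ∘ p0)‖ := norm_pos_iff.2 hp0
    exact norm_pos_iff.1 (h0.trans_le this)
  obtain ⟨hli, hsp⟩ := (Module.Basis.is_basis_iff_det b).2 (isUnit_iff_ne_zero.2 hpne)
  let B := Module.Basis.mk hli hsp.ge
  have hB : ∀ x, v x = ∑ i, B.repr (v x) i • v (p i) := by
    intro x
    conv_lhs => rw [← B.sum_repr (v x)]
    simp [B]
  refine ⟨p, fun x i => B.repr (v x) i, ?_, hB⟩
  intro x i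
  have key : b.det (v ∘ Function.update p i x) = B.repr (v x) i * b.det (v ∘ p) := by
    have h1 : v ∘ Function.update p i x = Function.update (v ∘ p) i (v x) := by
      ext j; by_cases h : j = i
      · subst h; simp
      · simp [h]
    rw [h1]
    conv_lhs => rw [hB x]
    rw [AlternatingMap.map_update_sum]
    rw [Finset.sum_eq_single i]
    · rw [AlternatingMap.map_update_smul]
      have : Function.update (v ∘ p) i (v (p i)) = v ∘ p := Function.update_eq_self i (v ∘ p)
      rw [this, smul_eq_mul]
    · intro j _ hj
      rw [AlternatingMap.map_update_smul]
      have := (b.det).map_update_self (v ∘ p) hj.symm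
      simp only [Function.comp] at this ⊢
      rw [this, smul_zero]
    · simp
  have := hpmax (Function.update p i x)
  rw [key, norm_mul] at this
  have h0 : 0 < ‖b.det (v ∘ p)‖ := norm_pos_iff.2 hpne
  exact le_of_mul_le_mul_right (by linarith) h0

lemma fekete' {V : Type*} [NormedAddCommGroup V] [NormedSpace ℂ V] [FiniteDimensional ℂ V]
    {X : Type*} [TopologicalSpace X] [CompactSpace X] (v : X → V) (hv : Continuous v) :
    ∃ r ≤ Module.finrank ℂ V, ∃ (p : Fin r → X) (l : X → Fin r → ℂ),
      (∀ x i, ‖l x i‖ ≤ 1) ∧ ∀ x, v x = ∑ i, l x i • v (p i) := by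
  let W := Submodule.span ℂ (Set.range v)
  let w : X → W := fun x => ⟨v x, Submodule.subset_span ⟨x, rfl⟩⟩
  have hw : Continuous w := hv.subtype_mk _
  have hspan : Submodule.span ℂ (Set.range w) = ⊤ := by
    have := Submodule.span_span_coe_preimage (R := ℂ) (s := Set.range v)
    rw [← this]
    congr 1
    ext ⟨y, hy⟩
    simp [w, W]
  obtain ⟨p, l, h1, h2⟩ := fekete w hw hspan
  refine ⟨_, Submodule.finrank_le W, p, l, h1, fun x => ?_⟩
  have := congrArg (Subtype.val) (h2 x)
  simpa [w] using this

lemma core {d : ℕ} {ω : (Fin d → ℤ) → ℝ} (hs : Summable fun k => ((ω k) ^ 2)⁻¹)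
    (n : ℕ) (T : Fin n → Coef d →L[ℂ] ℂ) (E : ℝ)
    (hE : ∀ u : Coef d, ‖u‖ ≤ 1 → (∀ i, T i u = 0) → ∀ x ∈ cube d, ‖torusFn ω u x‖ ≤ E) :
    ∃ (p : Fin n → Fin d → ℝ) (l : (Fin d → ℝ) → Fin n → ℂ), (∀ i, p i ∈ cube d) ∧
      ∀ u : Coef d, ‖u‖ ≤ 1 → ∀ x ∈ cube d,
        ‖torusFn ω u x - ∑ i, l x i * torusFn ω u (p i)‖ ≤ (n + 1) * E := by
  classical
  let TT : Coef d →L[ℂ] (Fin n → ℂ) := ContinuousLinearMap.pi T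
  let N : Submodule ℂ (Coef d) := TT.ker
  have hNc : IsClosed (N : Set (Coef d)) := ContinuousLinearMap.isClosed_ker TT
  have : CompleteSpace N := hNc.completeSpace_coe
  let V := Nᗮ
  let f : V →ₗ[ℂ] (Fin n → ℂ) := (TT : Coef d →ₗ[ℂ] (Fin n → ℂ)) ∘ₗ V.subtype
  have hf : Function.Injective f := by
    rw [← LinearMap.ker_eq_bot, LinearMap.ker_eq_bot']
    rintro ⟨y, hy⟩ h
    have hyN : y ∈ N := h
    have := Submodule.inner_right_of_mem_orthogonal hyN hy
    ext1
    simpa using this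
  have : FiniteDimensional ℂ V := FiniteDimensional.of_injective f hf
  have hdim : Module.finrank ℂ V ≤ n := by
    simpa using LinearMap.finrank_le_finrank_of_injective hf
  have : CompactSpace (cube d) := isCompact_iff_compactSpace.1 (cube_compact d)
  let P : Coef d →L[ℂ] Coef d := V.starProjection
  obtain ⟨r, hr, p, l, hl1, hl2⟩ := fekete' (fun x : cube d => V.orthogonalProjectionOnto (repK hs x))
    (V.orthogonalProjectionOnto.continuous.comp ((ker_cont hs).comp continuous_subtype_val))
  have hrn : r ≤ n := hr.trans hdim
  have h0 : (0 : Fin d → ℝ) ∈ cube d := fun j => by simp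
  have hE0 : 0 ≤ E := by
    have := hE 0 (by simp) (by simp) 0 h0
    exact (norm_nonneg _).trans this
  have main : ∀ u : Coef d, ‖u‖ ≤ 1 → ∀ x : cube d,
      ‖torusFn ω u x - ∑ i, (starRingEnd ℂ) (l x i) * torusFn ω u (p i)‖ ≤ (n + 1) * E := by
    intro u hu x
    let w : Coef d := N.starProjection u
    have hwN : w ∈ N := Submodule.starProjection_apply_mem N u
    have hw1 : ‖w‖ ≤ 1 := (Submodule.norm_starProjection_apply_le N u).trans hu
    have hz : u - w ∈ V := Submodule.sub_starProjection_mem_orthogonal u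
    have hwE : ∀ x ∈ cube d, ‖torusFn ω w x‖ ≤ E :=
      hE w hw1 (fun i => congrFun (show TT w = 0 from hwN) i)
    have hin : ∀ x : Fin d → ℝ, torusFn ω u x = torusFn ω w x +
        inner ℂ (V.orthogonalProjectionOnto (repK hs x)) (⟨u - w, hz⟩ : V) := by
      intro x
      rw [Submodule.inner_orthogonalProjectionOnto_eq_of_mem_right, torusFn_eq hs, torusFn_eq hs,
        ← inner_add_right]
      simp
    have heq : torusFn ω u x - ∑ i, (starRingEnd ℂ) (l x i) * torusFn ω u (p i)
        = torusFn ω w x - ∑ i, (starRingEnd ℂ) (l x i) * torusFn ω w (p i) := by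
      rw [hin x, hl2 x, sum_inner]
      simp only [hin (p _), inner_smul_left, mul_add, Finset.sum_add_distrib]
      ring
    rw [heq]
    calc _ ≤ ‖torusFn ω w x‖ + ∑ i, ‖(starRingEnd ℂ) (l x i) * torusFn ω w (p i)‖ :=
          (norm_sub_le _ _).trans (by gcongr; exact norm_sum_le _ _)
      _ ≤ E + ∑ i : Fin r, E := by
          gcongr with i
          · exact hwE x x.2
          · rw [norm_mul, RCLike.norm_conj]
            have := hwE (p i) (p i).2
            nlinarith [hl1 x i, norm_nonneg (l x i), norm_nonneg (torusFn ω w (p i))]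
      _ ≤ (n + 1) * E := by
          have : (r : ℝ) ≤ n := by exact_mod_cast hrn
          simp
          nlinarith
  refine ⟨fun i => if h : (i : ℕ) < r then p ⟨i, h⟩ else 0,
    fun x i => if h : (i : ℕ) < r then (if hx : x ∈ cube d then
      (starRingEnd ℂ) (l ⟨x, hx⟩ ⟨i, h⟩) else 0) else 0, ?_, ?_⟩
  · intro i
    dsimp only
    split_ifs
    · exact (p _).2
    · exact h0
  · intro u hu x hx
    have := main u hu ⟨x, hx⟩
    convert this using 3
    obtain ⟨m, rfl⟩ := Nat.exists_eq_add_of_le hrn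
    rw [Fin.sum_univ_add]
    simp [hx]

lemma wcErr_std_le {d : ℕ} {ω : (Fin d → ℤ) → ℝ} (hs : Summable fun k => ((ω k) ^ 2)⁻¹) (n : ℕ) :
    wcErr ω (stdInfo ω) n ≤ (n + 1) * wcErr ω (allInfo d) n := by
  have hn0 : (n + 1 : ℝ≥0∞) ≠ 0 := by simp
  have hnt : (n + 1 : ℝ≥0∞) ≠ ⊤ := by simp
  rw [mul_comm, ← ENNReal.div_le_iff hn0 hnt]
  conv_rhs => unfold wcErr
  refine le_iInf fun L => le_iInf fun hL => le_iInf fun φ => ?_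
  rw [ENNReal.div_le_iff hn0 hnt]
  set S : ℝ≥0∞ := ⨆ (u : Coef d) (_ : ‖u‖ ≤ 1) (x : Fin d → ℝ) (_ : x ∈ cube d),
      (‖torusFn ω u x - φ (fun i => L i u) x‖₊ : ℝ≥0∞) with hS
  by_cases hST : S = ⊤
  · rw [hST, ENNReal.top_mul hn0]; exact le_top
  have hb : ∀ u : Coef d, ‖u‖ ≤ 1 → ∀ x ∈ cube d,
      ‖torusFn ω u x - φ (fun i => L i u) x‖ ≤ S.toReal := by
    intro u hu x hx
    have h : (‖torusFn ω u x - φ (fun i => L i u) x‖₊ : ℝ≥0∞) ≤ S := by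
      rw [hS]
      exact le_iSup₂_of_le u hu (le_iSup₂_of_le x hx le_rfl)
    have := ENNReal.toReal_mono hST h
    simpa using this
  choose T hT using hL
  have hE : ∀ u : Coef d, ‖u‖ ≤ 1 → (∀ i, T i u = 0) → ∀ x ∈ cube d,
      ‖torusFn ω u x‖ ≤ S.toReal := by
    intro u hu h x hx
    have h1 := hb u hu x hx
    have h2 := hb (-u) (by simpa using hu) x hx
    simp only [hT, map_neg, h, neg_zero] at h1 h2
    have e : torusFn ω (-u) x = - torusFn ω u x := by
      simp [torusFn_eq hs]
    rw [e] at h2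
    set c := φ (fun _ => 0) x
    have h3 : ‖(2:ℂ) * torusFn ω u x‖ ≤ S.toReal + S.toReal := by
      have : (2:ℂ) * torusFn ω u x = (torusFn ω u x - c) - (-torusFn ω u x - c) := by ring
      rw [this]
      exact (norm_sub_le _ _).trans (add_le_add h1 h2)
    rw [norm_mul] at h3
    norm_num at h3
    linarith
  obtain ⟨p, l, hp, hl⟩ := core hs n T S.toReal hE
  conv_lhs => unfold wcErr
  refine iInf₂_le_of_le (fun i u => torusFn ω u (p i)) (fun i => ⟨_, hp i, rfl⟩) ?_
  refine iInf_le_of_le (fun y x => ∑ i, l x i * y i) ?_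
  refine iSup₂_le fun u hu => iSup₂_le fun x hx => ?_
  have := hl u hu x hx
  have h3 := ENNReal.ofReal_le_ofReal this
  rw [ofReal_norm, ENNReal.ofReal_mul (by positivity), ENNReal.ofReal_toReal hST,
    ENNReal.ofReal_add (by positivity) (by norm_num), mul_comm] at h3
  rw [ENNReal.ofReal_natCast, ENNReal.ofReal_one] at h3
  exact h3

lemma initErr_pos {d : ℕ} {ω : (Fin d → ℤ) → ℝ} (hp : ∀ k, 0 < ω k) : 0 < initErr ω := by
  classical
  let u : Coef d := lp.single 2 (0 : Fin d → ℤ) (1:ℂ)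
  have h0 : (0 : Fin d → ℝ) ∈ cube d := fun j => by simp
  have hu : ‖u‖ ≤ 1 := by
    simp [u]
  have hv : torusFn ω u 0 = ((ω 0 : ℂ))⁻¹ := by
    unfold torusFn
    rw [tsum_eq_single 0]
    · simp [u]
    · intro k hk
      simp [u, hk]
  have : (‖torusFn ω u 0‖₊ : ℝ≥0∞) ≤ initErr ω :=
    le_iSup₂_of_le u hu (le_iSup₂_of_le 0 h0 le_rfl)
  refine lt_of_lt_of_le ?_ this
  rw [hv]
  simp [(hp 0).ne']

lemma CRI_pos {d : ℕ} {ω : (Fin d → ℤ) → ℝ} (hp : ∀ k, 0 < ω k) (c : Crit) : 0 < CRI ω c := by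
  cases c
  · simp [CRI]
  · exact initErr_pos hp

lemma lognat_mono {a b : ℕ} (h : a ≤ b) : Real.log a ≤ Real.log b := by
  rcases Nat.eq_zero_or_pos a with rfl | ha
  · simpa using Real.log_natCast_nonneg b
  · exact Real.log_le_log (by exact_mod_cast ha) (by exact_mod_cast h)

lemma analytic_part (na ns : ℕ → ℝ → ℕ)
    (hle : ∀ d, 0 < d → ∀ ε ∈ Set.Ioo (0:ℝ) 1, ∀ ε' ∈ Set.Ioo (0:ℝ) 1,
      ((na d ε' : ℝ) + 1) * ε' ≤ ε → ns d ε ≤ na d ε')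
    (h : EXPUWT na) : EXPUWT ns := by
  intro α hα β hβ δ hδ
  have hC : 0 < (10:ℝ) ^ α + 1 := by positivity
  obtain ⟨M1, h1⟩ := h 1 one_pos (β / α) (by positivity) (1/4) (by norm_num)
  obtain ⟨M2, h2⟩ := h α hα β hβ (δ / ((10:ℝ) ^ α + 1)) (by positivity)
  refine ⟨max M1 M2, fun d hd ε hε hM => ?_⟩
  have hεp := hε.1
  set L := Real.log ε⁻¹ with hL
  have hLpos : 0 < L := Real.log_pos ((one_lt_inv₀ hεp).2 hε.2)
  set D := (d:ℝ) ^ (β / α) with hD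
  have hD0 : 0 ≤ D := by positivity
  set L' := 2 * L + D + 4 with hL'
  have hεL : ε = Real.exp (-L) := by
    rw [hL, Real.log_inv, neg_neg, Real.exp_log hεp]
  have hlog' : Real.log (Real.exp (-L'))⁻¹ = L' := by
    rw [← Real.exp_neg, neg_neg, Real.log_exp]
  have hε' : Real.exp (-L') ∈ Set.Ioo (0:ℝ) 1 :=
    ⟨Real.exp_pos _, by rw [← Real.exp_zero]; exact Real.exp_lt_exp.2 (by linarith)⟩
  have hM' : max M1 M2 ≤ (Real.exp (-L'))⁻¹ + d := by
    refine hM.trans ?_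
    rw [hεL, ← Real.exp_neg, ← Real.exp_neg]
    gcongr
    linarith
  have b1 := h1 d hd _ hε' ((le_max_left _ _).trans hM')
  have b2 := h2 d hd _ hε' ((le_max_right _ _).trans hM')
  simp only [hlog', Real.rpow_one] at b1 b2
  set m := na d (Real.exp (-L')) with hm
  have b1' := (abs_lt.1 b1).2
  have b2' := (abs_lt.1 b2).2
  have hdb : 0 < (d:ℝ) ^ β := Real.rpow_pos_of_pos (by exact_mod_cast hd) _
  rw [div_lt_iff₀ (by positivity)] at b1' b2'
  have hnm : ns d ε ≤ m := by
    refine hle d hd ε hε _ hε' ?_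
    have hm1 : (m : ℝ) + 1 ≤ 2 * Real.exp (Real.log m) := by
      rcases Nat.eq_zero_or_pos m with h0 | h0
      · rw [h0]; simp
      · have : (1:ℝ) ≤ m := by exact_mod_cast h0
        rw [Real.exp_log (by linarith)]; linarith
    have h2e : (2:ℝ) ≤ Real.exp 1 := by
      have := Real.add_one_le_exp (1:ℝ); linarith
    calc ((m:ℝ) + 1) * Real.exp (-L') ≤ (Real.exp 1 * Real.exp (Real.log m)) * Real.exp (-L') := by
          gcongr
          refine hm1.trans ?_
          gcongr
      _ = Real.exp (1 + Real.log m + -L') := by rw [Real.exp_add, Real.exp_add]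
      _ ≤ Real.exp (-L) := by
          gcongr
          linarith
      _ = ε := hεL.symm
  have hpow : (1 + L') ^ α ≤ (10:ℝ) ^ α * ((1 + L) ^ α + (d:ℝ) ^ β) := by
    have hDa : D ^ α = (d:ℝ) ^ β := by
      rw [hD, ← Real.rpow_mul (by positivity), div_mul_cancel₀ _ hα.ne']
    have hp1 : 0 ≤ (1 + L) ^ α := by positivity
    rcases le_total (1 + L) D with hc | hc
    · calc (1 + L') ^ α ≤ (10 * D) ^ α := by
            apply Real.rpow_le_rpow <;> linarith
        _ = 10 ^ α * (d:ℝ) ^ β := by rw [Real.mul_rpow (by norm_num) hD0, hDa]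
        _ ≤ _ := by gcongr; linarith
    · calc (1 + L') ^ α ≤ (10 * (1 + L)) ^ α := by
            apply Real.rpow_le_rpow <;> linarith
        _ = 10 ^ α * (1 + L) ^ α := by rw [Real.mul_rpow (by norm_num) (by linarith)]
        _ ≤ _ := by gcongr; linarith
  have hden : 0 < (1 + L) ^ α + (d:ℝ) ^ β := by positivity
  have hlog0 : 0 ≤ Real.log (ns d ε) := Real.log_natCast_nonneg _
  show |Real.log (ns d ε) / ((1 + L) ^ α + (d:ℝ) ^ β)| < δ
  rw [abs_of_nonneg (by positivity), div_lt_iff₀ hden]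
  calc Real.log (ns d ε) ≤ Real.log m := lognat_mono hnm
    _ < _ := b2'
    _ ≤ δ / ((10:ℝ) ^ α + 1) * (((10:ℝ) ^ α + 1) * ((1 + L) ^ α + (d:ℝ) ^ β)) := by
        gcongr
        have hp1 : 0 ≤ (1 + L) ^ α := by positivity
        linarith
    _ = δ * ((1 + L) ^ α + (d:ℝ) ^ β) := by field_simp

lemma mono_part (na ns : ℕ → ℝ → ℕ)
    (hle : ∀ d, 0 < d → ∀ ε ∈ Set.Ioo (0:ℝ) 1, na d ε ≤ ns d ε)
    (h : EXPUWT ns) : EXPUWT na := by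
  intro α hα β hβ δ hδ
  obtain ⟨M, hM⟩ := h α hα β hβ δ hδ
  refine ⟨M, fun d hd ε hε h1 => lt_of_le_of_lt ?_ (hM d hd ε hε h1)⟩
  rw [abs_div, abs_div]
  refine div_le_div_of_nonneg_right ?_ (abs_nonneg _)
  rw [abs_of_nonneg (Real.log_natCast_nonneg _), abs_of_nonneg (Real.log_natCast_nonneg _)]
  exact lognat_mono (hle d hd ε hε)

/-- EXP-UWT for `Λ^all` is equivalent to EXP-UWT for `Λ^std`,
for the absolute or normalized error criterion. -/
theorem stmt7
    (ω : (d : ℕ) → (Fin d → ℤ) → ℝ)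
    (hpos : ∀ d, 0 < d → ∀ k, 0 < ω d k)
    (hsum : ∀ d, 0 < d → Summable fun k => ((ω d k) ^ 2)⁻¹)
    (crit : Crit) :
    EXPUWT (fun d ε => infoComp (ω d) (allInfo d) crit ε) ↔
      EXPUWT (fun d ε => infoComp (ω d) (stdInfo (ω d)) crit ε) := by
  have hcpos : ∀ d, 0 < d → ∀ ε ∈ Set.Ioo (0:ℝ) 1,
      0 < ENNReal.ofReal ε * CRI (ω d) crit := fun d hd ε hε =>
    ENNReal.mul_pos (by simpa using hε.1) (CRI_pos (hpos d hd) crit).ne'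
  constructor
  · refine analytic_part _ _ fun d hd ε hε ε' hε' h => ?_
    have hne : {n : ℕ | wcErr (ω d) (allInfo d) n ≤ ENNReal.ofReal ε' * CRI (ω d) crit}.Nonempty := by
      obtain ⟨n, hn⟩ := std_nonempty (hsum d hd) (hcpos d hd ε' hε')
      exact ⟨n, (wcErr_anti (hsum d hd) n).trans hn⟩
    have hmem := Nat.sInf_mem hne
    refine Nat.sInf_le ?_
    set m := infoComp (ω d) (allInfo d) crit ε' with hm
    have hmem' : wcErr (ω d) (allInfo d) m ≤ ENNReal.ofReal ε' * CRI (ω d) crit := hmem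
    show wcErr (ω d) (stdInfo (ω d)) m ≤ ENNReal.ofReal ε * CRI (ω d) crit
    refine (wcErr_std_le (hsum d hd) m).trans ?_
    calc ((m:ℝ≥0∞) + 1) * wcErr (ω d) (allInfo d) m
        ≤ ((m:ℝ≥0∞) + 1) * (ENNReal.ofReal ε' * CRI (ω d) crit) := by gcongr
      _ = ENNReal.ofReal (((m:ℝ) + 1) * ε') * CRI (ω d) crit := by
          rw [ENNReal.ofReal_mul (by positivity), ENNReal.ofReal_add (by positivity) (by norm_num)]
          simp [mul_assoc]
      _ ≤ _ := by gcongr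
  · refine mono_part _ _ fun d hd ε hε => ?_
    have hne : {n : ℕ | wcErr (ω d) (stdInfo (ω d)) n ≤
        ENNReal.ofReal ε * CRI (ω d) crit}.Nonempty :=
      std_nonempty (hsum d hd) (hcpos d hd ε hε)
    exact Nat.sInf_le ((wcErr_anti (hsum d hd) _).trans (Nat.sInf_mem hne))
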